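/- Let N ≥ M ≥ 1 and let (e_i)_{i=1}^N be a unit-norm frame for ℝ^M that is both equiangular and tight. Then max_{1 ≤ i < j ≤ N} |⟨e_i, e_j⟩| = √((N − M)/(M(N − 1))), i.e., equality holds in the Welch bound. -/

import Mathlib

open scoped InnerProductSpace

/-- An equiangular tight unit-norm frame attains equality in the Welch bound. -/
theorem stmt_3 (M N : ℕ) (hM : 1 ≤ M) (hMN : M ≤ N)
    (e : Fin N → EuclideanSpace ℝ (Fin M))
    (hnorm : ∀ i, ‖e i‖ = 1)
    (hspan : Submodule.span ℝ (Set.range e) = ⊤)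
    (hequi : ∃ α : ℝ, ∀ i j : Fin N, i ≠ j → |(⟪e i, e j⟫_ℝ)| = α)
    (htight : ∃ A : ℝ, ∀ x : EuclideanSpace ℝ (Fin M),
      (∑ i : Fin N, ⟪x, e i⟫_ℝ • e i) = A • x) :
    (⨆ i : Fin N, ⨆ j : Fin N, ⨆ (_ : i < j), |(⟪e i, e j⟫_ℝ)|) =
      Real.sqrt (((N : ℝ) - M) / (M * ((N : ℝ) - 1))) := by
  obtain ⟨α, hα⟩ := hequi
  obtain ⟨A, hA⟩ := htight
  have hq : ∀ x : EuclideanSpace ℝ (Fin M), ∑ i, ⟪x, e i⟫_ℝ ^ 2 = A * ‖x‖ ^ 2 := by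
    intro x
    have h := congrArg (fun y => ⟪x, y⟫_ℝ) (hA x)
    simp only [inner_sum, inner_smul_right, real_inner_self_eq_norm_sq] at h
    rw [← h]
    exact Finset.sum_congr rfl fun i _ => sq _
  have hAM : A * M = N := by
    let b := EuclideanSpace.basisFun (Fin M) ℝ
    have h1 : ∑ k, ∑ i, ⟪b k, e i⟫_ℝ ^ 2 = A * M := by
      simp [hq, mul_comm]
    have h2 : ∀ i, ∑ k, ⟪b k, e i⟫_ℝ ^ 2 = 1 := by
      intro i
      have h := b.sum_sq_norm_inner_right (e i)
      simpa [hnorm] using h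
    rw [← h1, Finset.sum_comm]
    simp [h2]
  rcases Nat.lt_or_ge N 2 with hN | hN
  · obtain rfl : N = 1 := by omega
    obtain rfl : M = 1 := by omega
    simp
  have i0 : Fin N := ⟨0, by omega⟩
  let a : Fin N := ⟨0, by omega⟩
  let c : Fin N := ⟨1, by omega⟩
  have hac : a < c := by simp [a, c, Fin.lt_def]
  have hα0 : 0 ≤ α := by rw [← hα a c hac.ne]; exact abs_nonneg _
  have hS : 1 + ((N : ℝ) - 1) * α ^ 2 = A := by
    have h := hq (e a)
    rw [hnorm, ← Finset.add_sum_erase _ _ (Finset.mem_univ a),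
      Finset.sum_congr rfl (g := fun _ => α ^ 2)] at h
    · simp [hnorm, Nat.cast_sub (show 1 ≤ N by omega)] at h
      exact h
    · intro j hj
      rw [← hα a j (Finset.ne_of_mem_erase hj).symm, sq_abs]
  have hN' : (2 : ℝ) ≤ N := by exact_mod_cast hN
  have hM' : (1 : ℝ) ≤ M := by exact_mod_cast hM
  have hR : Real.sqrt (((N : ℝ) - M) / (M * ((N : ℝ) - 1))) = α := by
    have : ((N : ℝ) - M) / (M * ((N : ℝ) - 1)) = α ^ 2 := by
      rw [div_eq_iff (mul_ne_zero (by linarith) (by linarith)), ← hAM.trans rfl]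
      rw [hAM]
      linear_combination (-1 : ℝ) * hAM - (M : ℝ) * hS
    rw [this, Real.sqrt_sq hα0]
  rw [hR]
  apply le_antisymm
  · refine Real.iSup_le (fun i => Real.iSup_le (fun j => Real.iSup_le (fun h => ?_) hα0) hα0) hα0
    exact (hα i j h.ne).le
  · have h1 := le_ciSup (f := fun i : Fin N => ⨆ j : Fin N, ⨆ (_ : i < j), |(⟪e i, e j⟫_ℝ)|)
      (Set.finite_range _).bddAbove a
    have h2 := le_ciSup (f := fun j : Fin N => ⨆ (_ : a < j), |(⟪e a, e j⟫_ℝ)|)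
      (Set.finite_range _).bddAbove c
    refine le_trans ?_ (h2.trans h1)
    simp only [ciSup_pos hac]
    exact (hα a c hac.ne).ge
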